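/- arXiv:1806.10401 — 3 statements merged into one kernel-verified Lean document; each statement's English description precedes it below -/
import Mathlib

section
/- For every λ ∈ Σ_{ϑ₀} and every ξ ∈ ℝ^N, det(λ·I − A(ξ)) = (λ + γ₁|ξ|²)(λ + γ₂|ξ|²)(λ + γ₃|ξ|²) ≠ 0; in particular the matrix λ·I − A(ξ) is invertible for all λ ∈ Σ_{ϑ₀} and ξ ∈ ℝ^N. -/
/-- For every λ ∈ Σ_{ϑ₀} (with ϑ₀ = arg(−γ₃)) and every ξ ∈ ℝ^N,
`det(λI − A(ξ)) = (λ + γ₁|ξ|²)(λ + γ₂|ξ|²)(λ + γ₃|ξ|²) ≠ 0`; in particular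
the matrix λI − A(ξ) is invertible. -/
theorem symbol_matrix_invertible_on_sector
    (γ₁ : ℝ) (γ₂ γ₃ : ℂ)
    (hγ₃ : γ₃ = (starRingEnd ℂ) γ₂) (him : 0 < γ₂.im)
    (hfact : ∀ t : ℂ, t ^ 3 + t ^ 2 + 2 * t + 1
      = (t + (γ₁ : ℂ)) * (t + γ₂) * (t + γ₃))
    (N : ℕ) (hN : 2 ≤ N)
    (lam : ℂ) (hlam : lam ≠ 0 ∧ |lam.arg| < Complex.arg (-γ₃))
    (ξ : EuclideanSpace ℝ (Fin N)) :
    (lam • (1 : Matrix (Fin 3) (Fin 3) ℂ) -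
        !![0, 1, 0;
           -(‖ξ‖ : ℂ) ^ 4, 0, (‖ξ‖ : ℂ) ^ 2;
           0, -(‖ξ‖ : ℂ) ^ 2, -(‖ξ‖ : ℂ) ^ 2]).det
      = (lam + (γ₁ : ℂ) * (‖ξ‖ : ℂ) ^ 2) * (lam + γ₂ * (‖ξ‖ : ℂ) ^ 2)
          * (lam + γ₃ * (‖ξ‖ : ℂ) ^ 2) ∧
    (lam + (γ₁ : ℂ) * (‖ξ‖ : ℂ) ^ 2) * (lam + γ₂ * (‖ξ‖ : ℂ) ^ 2)
        * (lam + γ₃ * (‖ξ‖ : ℂ) ^ 2) ≠ 0 ∧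
    IsUnit (lam • (1 : Matrix (Fin 3) (Fin 3) ℂ) -
        !![0, 1, 0;
           -(‖ξ‖ : ℂ) ^ 4, 0, (‖ξ‖ : ℂ) ^ 2;
           0, -(‖ξ‖ : ℂ) ^ 2, -(‖ξ‖ : ℂ) ^ 2]) := by
  obtain ⟨hl0, hl⟩ := hlam
  have h0 := hfact 0
  have h1 := hfact 1
  have h2 := hfact (-1)
  have e3 : (γ₁ : ℂ) * γ₂ * γ₃ = 1 := by linear_combination -h0
  have e1 : (γ₁ : ℂ) + γ₂ + γ₃ = 1 := by
    linear_combination (-1 / 2 : ℂ) * h1 + (-1 / 2 : ℂ) * h2 + h0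
  have e2 : (γ₁ : ℂ) * γ₂ + γ₁ * γ₃ + γ₂ * γ₃ = 2 := by
    linear_combination (-1 / 2 : ℂ) * h1 + (1 / 2 : ℂ) * h2
  have hγ₁ : 0 < γ₁ := by
    have h : γ₁ * Complex.normSq γ₂ = 1 := by
      have h' := e3
      rw [hγ₃, mul_assoc, Complex.mul_conj] at h'
      exact_mod_cast h'
    have hn := Complex.normSq_nonneg γ₂
    by_contra hc
    nlinarith
  have hdet : (lam • (1 : Matrix (Fin 3) (Fin 3) ℂ) -
        !![0, 1, 0;
           -(‖ξ‖ : ℂ) ^ 4, 0, (‖ξ‖ : ℂ) ^ 2;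
           0, -(‖ξ‖ : ℂ) ^ 2, -(‖ξ‖ : ℂ) ^ 2]).det
      = (lam + (γ₁ : ℂ) * (‖ξ‖ : ℂ) ^ 2) * (lam + γ₂ * (‖ξ‖ : ℂ) ^ 2)
          * (lam + γ₃ * (‖ξ‖ : ℂ) ^ 2) := by
    rw [Matrix.det_fin_three]
    simp
    generalize (‖ξ‖ : ℂ) = r
    linear_combination (-lam ^ 2 * r ^ 2) * e1 - lam * r ^ 4 * e2 - r ^ 6 * e3
  have hne : (lam + (γ₁ : ℂ) * (‖ξ‖ : ℂ) ^ 2) * (lam + γ₂ * (‖ξ‖ : ℂ) ^ 2)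
        * (lam + γ₃ * (‖ξ‖ : ℂ) ^ 2) ≠ 0 := by
    have key : ∀ g : ℂ, Complex.arg (-γ₃) ≤ |Complex.arg (-g)| →
        lam + g * (‖ξ‖ : ℂ) ^ 2 ≠ 0 := by
      intro g hg h
      have hlg : lam = ((‖ξ‖ ^ 2 : ℝ) : ℂ) * (-g) := by
        push_cast
        linear_combination h
      have hr : 0 < ‖ξ‖ ^ 2 := by
        rcases (sq_nonneg ‖ξ‖).lt_or_eq with h | h
        · exact h
        · exact absurd (by rw [hlg, ← h]; simp) hl0
      rw [hlg, Complex.arg_real_mul _ hr] at hl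
      linarith
    refine mul_ne_zero (mul_ne_zero (key _ ?_) (key _ ?_)) (key _ (le_abs_self _))
    · have : Complex.arg (-(γ₁ : ℂ)) = Real.pi := by
        rw [← Complex.ofReal_neg]
        exact Complex.arg_ofReal_of_neg (by linarith)
      rw [this]
      exact (Complex.arg_le_pi _).trans (le_abs_self _)
    · have : -γ₃ = (starRingEnd ℂ) (-γ₂) := by rw [hγ₃, map_neg]
      rw [this, Complex.arg_conj]
      split_ifs with h
      · rw [h]; exact le_abs_self _
      · exact neg_le_abs _
  refine ⟨hdet, hne, ?_⟩
  rw [Matrix.isUnit_iff_isUnit_det, hdet]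
  exact hne.isUnit
end

section
/- Let ϑ ∈ (π/2, ϑ₀), λ₀ > 0 and j ∈ {0, 1, 2}. For every n ∈ ℕ there exists C > 0 such that for all λ ∈ λ₀ + Σ_ϑ and all ξ ∈ ℝ^N ∖ {0}: ‖∂ⁿ_ξ [ λ^{j/2} (1 + |ξ|²)^{(2−j)/2} (λ² + λ|ξ|² + |ξ|⁴) / ((λ + γ₁|ξ|²)(λ + γ₂|ξ|²)(λ + γ₃|ξ|²)) ]‖ ≤ C |ξ|^{−n}; i.e., the symbol m₁₁^{(j)}(ξ, λ) = λ^{j/2}(1+|ξ|²)^{(2−j)/2}(λ²+λ|ξ|²+|ξ|⁴)·det(λI−A(ξ))^{−1} is a multiplier of order 0 on λ₀ + Σ_ϑ. -/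
open Metric

lemma norm_iteratedFDeriv_id_le_aux {E : Type*} [NormedAddCommGroup E] [NormedSpace ℝ E]
    (x : E) (hx : x ≠ 0) (i : ℕ) :
    ‖iteratedFDeriv ℝ i (fun y : E => y) x‖ ≤ ‖x‖ * (1 / ‖x‖) ^ i := by
  have hx' : 0 < ‖x‖ := norm_pos_iff.2 hx
  rcases i with _ | i
  · simp
  · rw [← norm_iteratedFDeriv_fderiv]
    have : fderiv ℝ (fun y : E => y) = fun _ => ContinuousLinearMap.id ℝ E := by
      ext1 y; exact fderiv_id
    rw [this]
    rcases i with _ | i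
    · simp only [norm_iteratedFDeriv_zero]
      refine ContinuousLinearMap.norm_id_le.trans ?_
      simp [hx]
    · rw [iteratedFDeriv_const_of_ne (by simp)]
      simp only [Pi.zero_apply, norm_zero]
      positivity

lemma norm_iteratedFDeriv_sq_le_aux {E : Type*} [NormedAddCommGroup E] [InnerProductSpace ℝ E]
    (x : E) (hx : x ≠ 0) (i : ℕ) :
    ‖iteratedFDeriv ℝ i (fun y : E => ((‖y‖ ^ 2 / ‖x‖ ^ 2 : ℝ) : ℂ)) x‖ ≤ (2 / ‖x‖) ^ i := by
  have hx' : 0 < ‖x‖ := norm_pos_iff.2 hx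
  have hc : ContDiff ℝ (⊤ : ℕ∞) (fun y : E => ‖y‖ ^ 2) := contDiff_norm_sq ℝ
  have h1 : ‖iteratedFDeriv ℝ i (fun y : E => ‖y‖ ^ 2) x‖ ≤ ‖x‖ ^ 2 * (2 / ‖x‖) ^ i := by
    have h := (innerSL ℝ (E := E)).norm_iteratedFDeriv_le_of_bilinear_of_le_one
      (f := fun y : E => y) (g := fun y : E => y) (N := (⊤ : ℕ∞)) contDiff_id contDiff_id x
      (n := i) (by exact_mod_cast le_top) (norm_innerSL_le ℝ)
    have e : (fun y : E => (innerSL ℝ (E := E)) y y) = fun y : E => ‖y‖ ^ 2 := by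
      ext y; simp
    rw [e] at h
    refine h.trans ?_
    calc _ ≤ ∑ k ∈ Finset.range (i + 1), (i.choose k : ℝ) * (‖x‖ ^ 2 * (1 / ‖x‖) ^ i) := by
          refine Finset.sum_le_sum fun k hk => ?_
          have hk' : k ≤ i := by simpa [Nat.lt_succ_iff] using hk
          rw [mul_assoc]
          refine mul_le_mul_of_nonneg_left ?_ (by positivity)
          calc _ ≤ (‖x‖ * (1 / ‖x‖) ^ k) * (‖x‖ * (1 / ‖x‖) ^ (i - k)) :=
                mul_le_mul (norm_iteratedFDeriv_id_le_aux x hx k)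
                  (norm_iteratedFDeriv_id_le_aux x hx (i - k)) (norm_nonneg _) (by positivity)
            _ = ‖x‖ ^ 2 * (1 / ‖x‖) ^ i := by
                rw [← Nat.add_sub_cancel' hk', pow_add]
                simp; ring
      _ = ‖x‖ ^ 2 * (2 / ‖x‖) ^ i := by
          rw [← Finset.sum_mul, ← Nat.cast_sum, Nat.sum_range_choose]
          push_cast
          rw [div_pow, div_pow]; ring
  have e2 : (fun y : E => ((‖y‖ ^ 2 / ‖x‖ ^ 2 : ℝ) : ℂ))
      = Complex.ofRealLI ∘ (fun y : E => (‖x‖ ^ 2)⁻¹ • ‖y‖ ^ 2) := by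
    ext y; simp [div_eq_inv_mul]
  have hi : (i : WithTop ℕ∞) ≤ (⊤ : ℕ∞) := by exact_mod_cast le_top
  have hc2 : ContDiff ℝ (⊤ : ℕ∞) (fun y : E => (‖x‖ ^ 2)⁻¹ • ‖y‖ ^ 2) := hc.const_smul (‖x‖ ^ 2)⁻¹
  rw [e2, LinearIsometry.norm_iteratedFDeriv_comp_left _ hc2.contDiffAt hi,
    iteratedFDeriv_const_smul_apply' (hc.of_le hi).contDiffAt, norm_smul]
  rw [norm_inv, norm_pow, norm_norm]
  rw [inv_mul_le_iff₀ (by positivity)]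
  exact h1

/-- Radial chain rule with Cauchy estimates. -/
lemma radial_aux {E : Type*} [NormedAddCommGroup E] [InnerProductSpace ℝ E]
    (ε C : ℝ) (hε : 0 < ε) (hC : 0 ≤ C) (n : ℕ) (x : E) (hx : x ≠ 0) (H : ℂ → ℂ)
    (hd : DifferentiableOn ℂ H (ball 1 ε)) (hb : ∀ z ∈ ball (1:ℂ) ε, ‖H z‖ ≤ C) :
    ‖iteratedFDeriv ℝ n (fun y : E => H ((‖y‖ ^ 2 / ‖x‖ ^ 2 : ℝ) : ℂ)) x‖
      ≤ (n.factorial * (∑ i ∈ Finset.range (n + 1), i.factorial * C / (ε / 2) ^ i) * 2 ^ n)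
        * ‖x‖ ^ (-(n : ℝ)) := by
  have hx' : 0 < ‖x‖ := norm_pos_iff.2 hx
  set f : E → ℂ := fun y : E => ((‖y‖ ^ 2 / ‖x‖ ^ 2 : ℝ) : ℂ) with hf
  have hfx : f x = 1 := by
    simp [hf, hx]
  have hfc : ContDiff ℝ (⊤ : ℕ∞) f :=
    Complex.ofRealCLM.contDiff.comp ((contDiff_norm_sq ℝ).div_const _)
  have hopen : IsOpen (f ⁻¹' ball 1 ε) := isOpen_ball.preimage hfc.continuous
  have hHc : ContDiffOn ℂ (⊤ : ℕ∞) H (ball 1 ε) := hd.contDiffOn isOpen_ball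
  have hHr : ContDiffOn ℝ (⊤ : ℕ∞) H (ball 1 ε) := hHc.restrict_scalars ℝ
  have h1 : (1 : ℂ) ∈ ball (1 : ℂ) ε := mem_ball_self hε
  have hxs : x ∈ f ⁻¹' ball 1 ε := by simpa [hfx] using hε
  have key := norm_iteratedFDerivWithin_comp_le (n := n) (x := x)
    (C := ∑ i ∈ Finset.range (n + 1), i.factorial * C / (ε / 2) ^ i) (D := 2 / ‖x‖)
    hHr hfc.contDiffOn (s := f ⁻¹' ball 1 ε) (by exact_mod_cast le_top)
    isOpen_ball.uniqueDiffOn hopen.uniqueDiffOn (Set.mapsTo_preimage _ _) hxs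
    (by
      intro i hi
      rw [hfx, iteratedFDerivWithin_of_isOpen i isOpen_ball h1]
      have hat : ContDiffAt ℂ i H 1 :=
        (hHc.contDiffAt (isOpen_ball.mem_nhds h1)).of_le (by exact_mod_cast le_top)
      rw [← hat.restrictScalars_iteratedFDeriv (𝕜 := ℝ)]
      simp only [Function.comp_apply, ContinuousMultilinearMap.norm_restrictScalars]
      rw [norm_iteratedFDeriv_eq_norm_iteratedDeriv]
      refine (Complex.norm_iteratedDeriv_le_of_forall_mem_sphere_norm_le (R := ε / 2) (C := C) i
        (by positivity) ?_ ?_).trans ?_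
      · refine DifferentiableOn.diffContOnCl_ball (hd) ?_
        exact closedBall_subset_ball (by linarith)
      · intro z hz
        exact hb z (sphere_subset_closedBall.trans (closedBall_subset_ball (by linarith)) hz)
      · exact Finset.single_le_sum
          (f := fun i : ℕ => (i.factorial : ℝ) * C / (ε / 2) ^ i)
          (fun k _ => by positivity) (by simp; omega))
    (by
      intro i _ _
      rw [iteratedFDerivWithin_of_isOpen i hopen hxs]
      exact norm_iteratedFDeriv_sq_le_aux x hx i)
  rw [iteratedFDerivWithin_of_isOpen n hopen hxs] at key
  refine key.trans_eq ?_
  rw [Real.rpow_neg hx'.le, Real.rpow_natCast, div_pow]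
  ring

lemma sector_lower_aux (ϑ : ℝ) (hϑ : 0 < ϑ) (γ : ℂ) (hγ : γ ≠ 0) (h : ϑ < |Complex.arg (-γ)|) :
    ∃ c > 0, ∀ l : ℂ, |l.arg| ≤ ϑ → ∀ s : ℝ, 0 ≤ s → c * (‖l‖ + s) ≤ ‖l + γ * s‖ := by
  set ω := Complex.arg (-γ) with hω
  have hωπ : |ω| ≤ Real.pi := Complex.abs_arg_le_pi _
  set k := Real.cos (|ω| - ϑ) with hk
  have hk1 : k < 1 := by
    have : Real.cos (|ω| - ϑ) < Real.cos 0 :=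
      Real.cos_lt_cos_of_nonneg_of_le_pi le_rfl (by linarith) (by linarith)
    simpa using this
  have hk2 : -1 ≤ k := Real.neg_one_le_cos _
  have hγ' : 0 < ‖γ‖ := norm_pos_iff.2 hγ
  refine ⟨Real.sqrt ((1 - k) / 2) * min 1 ‖γ‖, mul_pos (Real.sqrt_pos.2 (by linarith))
    (lt_min one_pos hγ'), ?_⟩
  intro l hl s hs
  have hcos : Real.cos (l.arg - ω) ≤ k := by
    rw [hk, ← Real.cos_abs (l.arg - ω)]
    have hlo : |ω| - ϑ ≤ |l.arg - ω| := by
      have := abs_sub_abs_le_abs_sub ω l.arg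
      rw [abs_sub_comm] at this; linarith
    have hhi : |l.arg - ω| ≤ ϑ + |ω| := (abs_sub _ _).trans (by linarith)
    rcases le_or_gt |l.arg - ω| Real.pi with h1 | h1
    · exact Real.cos_le_cos_of_nonneg_of_le_pi (by linarith) h1 hlo
    · rw [← Real.cos_two_pi_sub]
      exact Real.cos_le_cos_of_nonneg_of_le_pi (by linarith) (by linarith) (by linarith)
  have hre : (l * (starRingEnd ℂ) (-γ)).re = ‖l‖ * ‖γ‖ * Real.cos (l.arg - ω) := by
    have a1 := Complex.norm_mul_cos_arg l
    have a2 := Complex.norm_mul_sin_arg l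
    have b1 := Complex.norm_mul_cos_arg (-γ)
    have b2 := Complex.norm_mul_sin_arg (-γ)
    rw [norm_neg] at b1 b2
    rw [Real.cos_sub, Complex.mul_re, Complex.conj_re, Complex.conj_im, ← a1, ← a2, ← b1, ← b2]
    ring
  have hsq : ‖l + γ * s‖ ^ 2 = ‖l‖ ^ 2 + (‖γ‖ * s) ^ 2
      - 2 * (‖l‖ * (‖γ‖ * s)) * Real.cos (l.arg - ω) := by
    have : 2 * (‖l‖ * (‖γ‖ * s)) * Real.cos (l.arg - ω)
      = 2 * s * (l * (starRingEnd ℂ) (-γ)).re := by rw [hre]; ring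
    rw [this, mul_pow, Complex.sq_norm, Complex.sq_norm, Complex.sq_norm]
    simp [Complex.normSq_apply]
    ring
  have hnn : 0 ≤ ‖l‖ * (‖γ‖ * s) := by positivity
  have h2 : (1 - k) / 2 * (‖l‖ + ‖γ‖ * s) ^ 2 ≤ ‖l + γ * s‖ ^ 2 := by
    rw [hsq]
    have := mul_le_mul_of_nonneg_left hcos hnn
    have := mul_nonneg (by linarith : 0 ≤ (1 + k)) (sq_nonneg (‖l‖ - ‖γ‖ * s))
    nlinarith
  have h3 : Real.sqrt ((1 - k) / 2) * (‖l‖ + ‖γ‖ * s) ≤ ‖l + γ * s‖ := by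
    refine (sq_le_sq₀ (by positivity) (norm_nonneg _)).1 ?_
    rw [mul_pow, Real.sq_sqrt (by linarith)]
    exact h2
  refine le_trans ?_ h3
  rw [mul_assoc]
  refine mul_le_mul_of_nonneg_left ?_ (Real.sqrt_nonneg _)
  have m1 := mul_le_mul_of_nonneg_right (min_le_left 1 ‖γ‖) (norm_nonneg l)
  have m2 := mul_le_mul_of_nonneg_right (min_le_right 1 ‖γ‖) hs
  nlinarith

lemma sector_shift_aux (ϑ : ℝ) (hϑ1 : Real.pi / 2 < ϑ) (hϑ2 : ϑ < Real.pi) (a : ℝ) (ha : 0 < a)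
    (μ : ℂ) (h : |μ.arg| < ϑ) : |((a : ℂ) + μ).arg| ≤ ϑ := by
  have hc : Real.cos ϑ ≤ 0 := Real.cos_nonpos_of_pi_div_two_le_of_le hϑ1.le (by linarith)
  have h1 : ‖μ‖ * Real.cos ϑ ≤ μ.re := by
    rw [← Complex.norm_mul_cos_arg μ]
    refine mul_le_mul_of_nonneg_left ?_ (norm_nonneg _)
    rw [← Real.cos_abs μ.arg]
    exact Real.cos_le_cos_of_nonneg_of_le_pi (abs_nonneg _) hϑ2.le h.le
  by_contra hcon
  push Not at hcon
  have h0 : (a : ℂ) + μ ≠ 0 := by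
    intro h0; rw [h0] at hcon; simp at hcon; linarith [Real.pi_pos]
  have hpos := norm_pos_iff.2 h0
  have h2 : ‖(a : ℂ) + μ‖ * Real.cos ((a : ℂ) + μ).arg < ‖(a : ℂ) + μ‖ * Real.cos ϑ := by
    refine mul_lt_mul_of_pos_left ?_ hpos
    rw [← Real.cos_abs ((a : ℂ) + μ).arg]
    exact Real.cos_lt_cos_of_nonneg_of_le_pi (by linarith [Real.pi_pos])
      (Complex.abs_arg_le_pi _) hcon
  rw [Complex.norm_mul_cos_arg] at h2
  have h3 : ‖μ‖ - a ≤ ‖(a : ℂ) + μ‖ := by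
    have := norm_sub_le ((a : ℂ) + μ) a
    simp [abs_of_pos ha] at this
    linarith
  have h4 := mul_le_mul_of_nonpos_right h3 hc
  have h5 := Real.neg_one_le_cos ϑ
  simp at h2
  nlinarith

lemma perturb_aux (γ l : ℂ) (c ε s : ℝ) (hs : 0 ≤ s) (hε : ε * ‖γ‖ ≤ c / 2)
    (h : c * (‖l‖ + s) ≤ ‖l + γ * s‖) (hc : 0 < c) (z : ℂ) (hz : z ∈ ball (1 : ℂ) ε) :
    c / 2 * (‖l‖ + s) ≤ ‖l + γ * (s * z)‖ := by
  rw [mem_ball, dist_eq_norm] at hz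
  have h1 : ‖γ * s * (1 - z)‖ ≤ c / 2 * s := by
    rw [norm_mul, norm_mul, Complex.norm_real, Real.norm_of_nonneg hs, norm_sub_rev]
    calc ‖γ‖ * s * ‖z - 1‖ ≤ ‖γ‖ * s * ε := by gcongr
      _ = ε * ‖γ‖ * s := by ring
      _ ≤ _ := by gcongr
  have h2 := norm_sub_le (l + γ * (s * z) + γ * s * (1 - z)) (γ * s * (1 - z))
  have h3 := norm_add_le (l + γ * (s * z)) (γ * s * (1 - z))
  have e : l + γ * (s * z) + γ * s * (1 - z) = l + γ * s := by ring
  rw [e] at h3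
  nlinarith [norm_nonneg l]

lemma bound_aux (γ₁ γ₂ γ₃ l : ℂ) (c ε b s : ℝ) (hs : 0 ≤ s) (hc : 0 < c) (hb : 0 < b)
    (hlb : b ≤ ‖l‖) (hε : ε ≤ 1 / 2) (j : ℕ) (hj : j ≤ 2) (z : ℂ) (hz : z ∈ ball (1 : ℂ) ε)
    (h1 : c * (‖l‖ + s) ≤ ‖l + γ₁ * (s * z)‖) (h2 : c * (‖l‖ + s) ≤ ‖l + γ₂ * (s * z)‖)
    (h3 : c * (‖l‖ + s) ≤ ‖l + γ₃ * (s * z)‖) :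
    ‖l ^ ((j : ℂ) / 2) * (1 + s * z) ^ ((((2 : ℝ) - j) / 2 : ℝ) : ℂ)
      * (l ^ 2 + l * (s * z) + (s * z) ^ 2)
      / ((l + γ₁ * (s * z)) * (l + γ₂ * (s * z)) * (l + γ₃ * (s * z)))‖
      ≤ 2 * (1 / b + 1) * 8 / c ^ 3 := by
  rw [mem_ball, dist_eq_norm] at hz
  set M := ‖l‖ + s with hM
  have hl : 0 < ‖l‖ := hb.trans_le hlb
  have hMp : 0 < M := by positivity
  set K := 2 * (1 / b + 1) with hK
  have hK1 : 1 ≤ K := by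
    have : 0 < 1 / b := by positivity
    rw [hK]; linarith
  have hz2 : ‖z‖ ≤ 3 / 2 := by
    have := norm_add_le (z - 1) 1
    simp at this; linarith
  have hw : ‖(s : ℂ) * z‖ ≤ 3 / 2 * s := by
    rw [norm_mul, Complex.norm_real, Real.norm_of_nonneg hs]
    nlinarith
  have hjr : (j : ℝ) ≤ 2 := by exact_mod_cast hj
  have hwl : ‖1 + (s : ℂ) * z‖ ≤ K * M := by
    have h4 := norm_add_le 1 ((s : ℂ) * z)
    rw [norm_one] at h4
    have h5 : 1 ≤ 1 / b * M := by
      rw [one_div, ← div_eq_inv_mul, le_div_iff₀ hb]; linarith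
    have : K * M = 2 * (1 / b * M) + 2 * M := by rw [hK]; ring
    rw [this]
    linarith
  have p1 : ‖l ^ ((j : ℂ) / 2)‖ ≤ M ^ ((j : ℝ) / 2) := by
    have : ((j : ℂ) / 2) = (((j : ℝ) / 2 : ℝ) : ℂ) := by push_cast; rfl
    rw [this, Complex.norm_cpow_real]
    exact Real.rpow_le_rpow hl.le (by linarith) (by positivity)
  have p2 : ‖(1 + (s : ℂ) * z) ^ ((((2 : ℝ) - j) / 2 : ℝ) : ℂ)‖ ≤ K * M ^ (((2 : ℝ) - j) / 2) := by
    rw [Complex.norm_cpow_real]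
    refine (Real.rpow_le_rpow (norm_nonneg _) hwl (by linarith)).trans ?_
    rw [Real.mul_rpow (by positivity) hMp.le]
    gcongr
    calc K ^ (((2 : ℝ) - j) / 2) ≤ K ^ (1 : ℝ) :=
          Real.rpow_le_rpow_of_exponent_le hK1 (by
            have : (0 : ℝ) ≤ j := by positivity
            linarith)
      _ = K := Real.rpow_one K
  have p12 : M ^ ((j : ℝ) / 2) * (K * M ^ (((2 : ℝ) - j) / 2)) = K * M := by
    have : M ^ ((j : ℝ) / 2) * M ^ (((2 : ℝ) - j) / 2) = M := by
      rw [← Real.rpow_add hMp]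
      have : (j : ℝ) / 2 + ((2 : ℝ) - j) / 2 = 1 := by ring
      rw [this, Real.rpow_one]
    calc _ = K * (M ^ ((j : ℝ) / 2) * M ^ (((2 : ℝ) - j) / 2)) := by ring
      _ = _ := by rw [this]
  have p3 : ‖l ^ 2 + l * (s * z) + (s * z) ^ 2‖ ≤ 8 * M ^ 2 := by
    have q1 := norm_add₃_le (a := l ^ 2) (b := l * (s * z)) (c := ((s : ℂ) * z) ^ 2)
    rw [norm_pow, norm_mul l, norm_pow ((s : ℂ) * z)] at q1
    have hn := norm_nonneg ((s : ℂ) * z)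
    nlinarith [mul_le_mul_of_nonneg_left hw hl.le, pow_le_pow_left₀ hn hw 2, mul_nonneg hl.le hs]
  rw [norm_div, norm_mul, norm_mul, norm_mul (_ * _) (l + γ₃ * _), norm_mul (l + γ₁ * _)]
  have hnum : ‖l ^ ((j : ℂ) / 2)‖ * ‖(1 + (s : ℂ) * z) ^ ((((2 : ℝ) - j) / 2 : ℝ) : ℂ)‖
      * ‖l ^ 2 + l * (s * z) + (s * z) ^ 2‖ ≤ K * M * (8 * M ^ 2) := by
    refine mul_le_mul ?_ p3 (norm_nonneg _) (by positivity)
    rw [← p12]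
    exact mul_le_mul p1 p2 (norm_nonneg _) (by positivity)
  have hden : c * M * (c * M) * (c * M)
      ≤ ‖l + γ₁ * (s * z)‖ * ‖l + γ₂ * (s * z)‖ * ‖l + γ₃ * (s * z)‖ := by
    gcongr
  refine (div_le_div₀ (by positivity) hnum (by positivity) hden).trans_eq ?_
  field_simp

theorem m11_multiplier_order_zero
    (γ₁ : ℝ) (γ₂ γ₃ : ℂ)
    (hγ₃ : γ₃ = (starRingEnd ℂ) γ₂) (him : 0 < γ₂.im)
    (hfact : ∀ t : ℂ, t ^ 3 + t ^ 2 + 2 * t + 1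
      = (t + (γ₁ : ℂ)) * (t + γ₂) * (t + γ₃))
    (ϑ : ℝ) (hϑ1 : Real.pi / 2 < ϑ) (hϑ2 : ϑ < Complex.arg (-γ₃))
    (lam₀ : ℝ) (hlam₀ : 0 < lam₀)
    (j : ℕ) (hj : j ≤ 2)
    (N : ℕ) (hN : 2 ≤ N) (n : ℕ) :
    ∃ C > 0, ∀ lam : ℂ,
      (∃ μ : ℂ, μ ≠ 0 ∧ |μ.arg| < ϑ ∧ lam = (lam₀ : ℂ) + μ) →
      ∀ ξ : EuclideanSpace ℝ (Fin N), ξ ≠ 0 →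
        ‖iteratedFDeriv ℝ n
            (fun ξ : EuclideanSpace ℝ (Fin N) =>
              lam ^ ((j : ℂ) / 2)
                * ((((1 + ‖ξ‖ ^ 2) ^ (((2 : ℝ) - j) / 2) : ℝ)) : ℂ)
                * (lam ^ 2 + lam * (‖ξ‖ : ℂ) ^ 2 + (‖ξ‖ : ℂ) ^ 4)
                / ((lam + (γ₁ : ℂ) * (‖ξ‖ : ℂ) ^ 2) * (lam + γ₂ * (‖ξ‖ : ℂ) ^ 2)
                    * (lam + γ₃ * (‖ξ‖ : ℂ) ^ 2))) ξ‖
          ≤ C * ‖ξ‖ ^ (-(n : ℝ)) := by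
  have hpi := Real.pi_pos
  have hϑπ : ϑ < Real.pi := hϑ2.trans_le (Complex.arg_le_pi _)
  have hϑ0 : 0 < ϑ := by linarith
  have hγ1 : 0 < γ₁ := by
    have h := hfact (-(γ₁ : ℂ))
    have h' : (-γ₁) ^ 3 + (-γ₁) ^ 2 + 2 * (-γ₁) + 1 = (0 : ℝ) := by
      rw [neg_add_cancel, zero_mul, zero_mul] at h
      exact_mod_cast h
    by_contra hn
    push Not at hn
    have : 0 ≤ (-γ₁) ^ 3 := pow_nonneg (by linarith) 3
    nlinarith [sq_nonneg γ₁]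
  have hγ2 : γ₂ ≠ 0 := by rintro rfl; simp at him
  have hγ3 : γ₃ ≠ 0 := by rw [hγ₃]; simpa using hγ2
  have pos_arg : ∀ x : ℝ, 0 < x → ϑ < |Complex.arg (-(x : ℂ))| := by
    intro x hx
    have : Complex.arg (-(x : ℂ)) = Real.pi := by
      rw [← Complex.ofReal_neg]; exact Complex.arg_ofReal_of_neg (by linarith)
    rw [this, abs_of_pos hpi]; exact hϑπ
  have arg3 : ϑ < |Complex.arg (-γ₃)| := hϑ2.trans_le (le_abs_self _)
  have arg2 : ϑ < |Complex.arg (-γ₂)| := by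
    have e : -γ₂ = (starRingEnd ℂ) (-γ₃) := by rw [hγ₃]; simp
    rw [e, Complex.arg_conj]
    split_ifs
    · rwa [abs_of_pos hpi]
    · rwa [abs_neg]
  obtain ⟨c₀, hc₀, H₀⟩ := sector_lower_aux ϑ hϑ0 ((1 : ℝ) : ℂ) (by simp) (pos_arg 1 one_pos)
  obtain ⟨c₁, hc₁, H₁⟩ := sector_lower_aux ϑ hϑ0 (γ₁ : ℂ) (by exact_mod_cast hγ1.ne')
    (pos_arg γ₁ hγ1)
  obtain ⟨c₂, hc₂, H₂⟩ := sector_lower_aux ϑ hϑ0 γ₂ hγ2 arg2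
  obtain ⟨c₃, hc₃, H₃⟩ := sector_lower_aux ϑ hϑ0 γ₃ hγ3 arg3
  obtain ⟨c, hc, hcc₁, hcc₂, hcc₃⟩ : ∃ c > 0, c ≤ c₁ ∧ c ≤ c₂ ∧ c ≤ c₃ :=
    ⟨min c₁ (min c₂ c₃), by positivity, min_le_left _ _,
      (min_le_right _ _).trans (min_le_left _ _), (min_le_right _ _).trans (min_le_right _ _)⟩
  set G := ‖(γ₁ : ℂ)‖ + ‖γ₂‖ + ‖γ₃‖ + 1 with hG
  have n1 := norm_nonneg (γ₁ : ℂ)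
  have n2 := norm_nonneg γ₂
  have n3 := norm_nonneg γ₃
  have hGp : 0 < G := by positivity
  obtain ⟨ε, hε, hε1, hε2⟩ : ∃ ε > 0, ε ≤ 1 / 2 ∧ ε * G ≤ c / 2 := by
    refine ⟨min (1 / 2) (c / 2 / G), by positivity, min_le_left _ _, ?_⟩
    rw [← le_div_iff₀ hGp]; exact min_le_right _ _
  have hεγ : ∀ g : ℂ, ‖g‖ ≤ G → ε * ‖g‖ ≤ c / 2 := fun g hg =>
    (mul_le_mul_of_nonneg_left hg hε.le).trans hε2
  set b := c₀ * lam₀ with hbdef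
  have hb : 0 < b := by positivity
  set C := 2 * (1 / b + 1) * 8 / (c / 2) ^ 3 with hC
  have hCp : 0 < C := by positivity
  refine ⟨n.factorial * (∑ i ∈ Finset.range (n + 1), i.factorial * C / (ε / 2) ^ i) * 2 ^ n,
    ?_, ?_⟩
  · have : 0 < ∑ i ∈ Finset.range (n + 1), i.factorial * C / (ε / 2) ^ i :=
      Finset.sum_pos (fun i _ => by positivity) (by simp)
    positivity
  rintro lam ⟨μ, hμ0, hμ, rfl⟩ ξ hξ
  have hlam := sector_shift_aux ϑ hϑ1 hϑπ lam₀ hlam₀ μ hμ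
  have hlb : b ≤ ‖(lam₀ : ℂ) + μ‖ := by
    have h := H₀ μ hμ.le lam₀ hlam₀.le
    rw [Complex.ofReal_one, one_mul, add_comm μ] at h
    refine le_trans ?_ h
    rw [hbdef]
    gcongr
    linarith [norm_nonneg μ]
  generalize (lam₀ : ℂ) + μ = l at hlam hlb
  have hR : 0 < ‖ξ‖ := norm_pos_iff.2 hξ
  set s := ‖ξ‖ ^ 2 with hs
  have hsp : 0 < s := by positivity
  have hlow : ∀ (g : ℂ) (c' : ℝ), c ≤ c' → ‖g‖ ≤ G →
      (∀ l : ℂ, |l.arg| ≤ ϑ → ∀ s : ℝ, 0 ≤ s → c' * (‖l‖ + s) ≤ ‖l + g * s‖) →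
      ∀ z ∈ ball (1 : ℂ) ε, c / 2 * (‖l‖ + s) ≤ ‖l + g * (s * z)‖ := by
    intro g c' hcc hg hh z hz
    refine perturb_aux g l c ε s hsp.le (hεγ g hg) ?_ hc z hz
    refine le_trans ?_ (hh l hlam s hsp.le)
    gcongr
  have L1 := hlow γ₁ c₁ hcc₁ (by linarith) H₁
  have L2 := hlow γ₂ c₂ hcc₂ (by linarith) H₂
  have L3 := hlow γ₃ c₃ hcc₃ (by linarith) H₃
  have hM : 0 < c / 2 * (‖l‖ + s) := by positivity
  have key := radial_aux ε C hε hCp.le n ξ hξ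
    (fun z => l ^ ((j : ℂ) / 2) * (1 + s * z) ^ ((((2 : ℝ) - j) / 2 : ℝ) : ℂ)
      * (l ^ 2 + l * (s * z) + (s * z) ^ 2)
      / ((l + γ₁ * (s * z)) * (l + γ₂ * (s * z)) * (l + γ₃ * (s * z))))
    (by
      intro z hz
      have d1 : l + γ₁ * (s * z) ≠ 0 := norm_pos_iff.1 (hM.trans_le (L1 z hz))
      have d2 : l + γ₂ * (s * z) ≠ 0 := norm_pos_iff.1 (hM.trans_le (L2 z hz))
      have d3 : l + γ₃ * (s * z) ≠ 0 := norm_pos_iff.1 (hM.trans_le (L3 z hz))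
      have hslit : 1 + (s : ℂ) * z ∈ Complex.slitPlane := by
        left
        rw [mem_ball, dist_eq_norm] at hz
        have h1 := (Complex.abs_re_le_norm (z - 1)).trans hz.le
        have h2 := (abs_le.1 h1).1
        simp at h2
        have : 0 ≤ z.re := by linarith
        simp
        positivity
      apply DifferentiableAt.differentiableWithinAt
      refine DifferentiableAt.div ?_ (by fun_prop) (mul_ne_zero (mul_ne_zero d1 d2) d3)
      refine DifferentiableAt.mul (DifferentiableAt.mul (by fun_prop) ?_) (by fun_prop)
      exact DifferentiableAt.cpow (by fun_prop) (by fun_prop) hslit)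
    (fun z hz => bound_aux γ₁ γ₂ γ₃ l (c / 2) ε b s hsp.le (by positivity) hb hlb hε1 j hj z hz
      (L1 z hz) (L2 z hz) (L3 z hz))
  refine le_trans (le_of_eq ?_) key
  congr 2
  funext y
  have e1 : (s : ℂ) * ((‖y‖ ^ 2 / ‖ξ‖ ^ 2 : ℝ) : ℂ) = (‖y‖ : ℂ) ^ 2 := by
    rw [← Complex.ofReal_mul, ← hs, mul_div_cancel₀ _ hsp.ne']
    push_cast; rfl
  rw [e1, Complex.ofReal_cpow (by positivity)]
  push_cast
  ring
end

section
/- Let ϑ ∈ (π/2, ϑ₀), λ₀ > 0 and j ∈ {0, 1, 2}. For every n ∈ ℕ there exists C > 0 such that for all λ ∈ λ₀ + Σ_ϑ and all ξ ∈ ℝ^N ∖ {0}: ‖∂ⁿ_ξ [ λ^{j/2} (1 + |ξ|²)^{(2−j)/2} (λ + |ξ|²) |ξ|⁴ (1 + |ξ|²)^{−1} / ((λ + γ₁|ξ|²)(λ + γ₂|ξ|²)(λ + γ₃|ξ|²)) ]‖ ≤ C |ξ|^{−n}; i.e., the symbol m₂₁^{(j)}(ξ, λ) = −λ^{j/2}(1+|ξ|²)^{(2−j)/2}(λ+|ξ|²)·(|ξ|²/(1+|ξ|²))·|ξ|²·det(λI−A(ξ))^{−1}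 is a multiplier of order 0 on λ₀ + Σ_ϑ. -/
open scoped ContDiff

/-- Uniform symbol estimates, with weight `w`, for a family of functions on `E` minus the origin. -/
structure UnifSym {ι E V : Type*} [NormedAddCommGroup E] [NormedSpace ℝ E]
    [NormedAddCommGroup V] [NormedSpace ℝ V] (F : ι → E → V) (w : ι → E → ℝ) : Prop where
  smooth : ∀ i, ContDiffOn ℝ ∞ (F i) {0}ᶜ
  bound : ∀ n : ℕ, ∃ C : ℝ, 0 ≤ C ∧ ∀ i, ∀ x : E, x ≠ 0 →
    ‖iteratedFDerivWithin ℝ n (F i) {0}ᶜ x‖ ≤ C * w i x * (‖x‖⁻¹) ^ n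

section UnifSymLemmas

variable {ι E V W X : Type*} [NormedAddCommGroup E] [NormedSpace ℝ E]
  [NormedAddCommGroup V] [NormedSpace ℝ V] [NormedAddCommGroup W] [NormedSpace ℝ W]
  [NormedAddCommGroup X] [NormedSpace ℝ X]

theorem UnifSym.uniqueDiff : UniqueDiffOn ℝ ({0}ᶜ : Set E) :=
  isOpen_compl_singleton.uniqueDiffOn

theorem UnifSym.mono {F : ι → E → V} {w w' : ι → E → ℝ} (h : UnifSym F w) (K : ℝ) (hK : 0 ≤ K)
    (hw : ∀ i x, x ≠ 0 → w i x ≤ K * w' i x) : UnifSym F w' := by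
  refine ⟨h.smooth, fun n => ?_⟩
  obtain ⟨C, hC, hb⟩ := h.bound n
  refine ⟨C * K, by positivity, fun i x hx => (hb i x hx).trans ?_⟩
  rw [mul_assoc C K]
  have := hw i x hx
  gcongr

theorem UnifSym.const (c : ι → V) : UnifSym (fun i (_ : E) => c i) (fun i _ => ‖c i‖) := by
  refine ⟨fun i => contDiffOn_const, fun n => ⟨1, zero_le_one, fun i x hx => ?_⟩⟩
  rcases n with _ | n
  · simp
  · rw [iteratedFDerivWithin_succ_const]
    simp only [Pi.zero_apply, norm_zero]
    positivity

theorem UnifSym.id : UnifSym (fun (_ : ι) (x : E) => x) (fun _ x => ‖x‖) := by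
  refine ⟨fun i => contDiffOn_id, fun n => ⟨1, zero_le_one, fun i x hx => ?_⟩⟩
  have hx' : ‖x‖ ≠ 0 := norm_ne_zero_iff.2 hx
  rcases n with _ | n
  · simp
  · rw [← norm_iteratedFDerivWithin_fderivWithin UnifSym.uniqueDiff hx]
    have h1 : Set.EqOn (fderivWithin ℝ (fun x : E => x) {0}ᶜ)
        (fun _ => ContinuousLinearMap.id ℝ E) {0}ᶜ := fun y hy =>
      fderivWithin_fun_id (UnifSym.uniqueDiff y hy)
    rw [iteratedFDerivWithin_congr h1 hx]
    rcases n with _ | n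
    · simp only [norm_iteratedFDerivWithin_zero]
      refine ContinuousLinearMap.norm_id_le.trans (le_of_eq ?_)
      rw [zero_add, pow_one, one_mul, mul_inv_cancel₀ hx']
    · rw [iteratedFDerivWithin_succ_const]
      simp only [Pi.zero_apply, norm_zero]
      positivity

theorem UnifSym.add {F G : ι → E → V} {w : ι → E → ℝ} (hF : UnifSym F w) (hG : UnifSym G w) :
    UnifSym (fun i x => F i x + G i x) w := by
  refine ⟨fun i => (hF.smooth i).add (hG.smooth i), fun n => ?_⟩
  obtain ⟨C, hC, hb⟩ := hF.bound n
  obtain ⟨C', hC', hb'⟩ := hG.bound n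
  refine ⟨C + C', by positivity, fun i x hx => ?_⟩
  have h1 := (hF.smooth i x hx).of_le (show (n : ℕ∞ω) ≤ ∞ by exact_mod_cast le_top)
  have h2 := (hG.smooth i x hx).of_le (show (n : ℕ∞ω) ≤ ∞ by exact_mod_cast le_top)
  have := iteratedFDerivWithin_add_apply h1 h2 UnifSym.uniqueDiff hx
  have h3 : (fun x => F i x + G i x) = F i + G i := rfl
  rw [h3, this]
  refine (norm_add_le _ _).trans ?_
  linarith [hb i x hx, hb' i x hx]

theorem UnifSym.bilin (B : V →L[ℝ] W →L[ℝ] X) {F : ι → E → V} {G : ι → E → W}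
    {w w' : ι → E → ℝ} (hw : ∀ i x, 0 ≤ w i x) (hF : UnifSym F w) (hG : UnifSym G w') :
    UnifSym (fun i x => B (F i x) (G i x)) (fun i x => w i x * w' i x) := by
  refine ⟨fun i => B.isBoundedBilinearMap.contDiff.comp_contDiffOn
    ((hF.smooth i).prodMk (hG.smooth i)), fun n => ?_⟩
  choose C hC hb using hF.bound
  choose C' hC' hb' using hG.bound
  refine ⟨‖B‖ * ∑ k ∈ Finset.range (n + 1), (n.choose k : ℝ) * C k * C' (n - k), ?_,
    fun i x hx => ?_⟩
  · refine mul_nonneg (by positivity) (Finset.sum_nonneg fun k _ =>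
      mul_nonneg (mul_nonneg (by positivity) (hC _)) (hC' _))
  refine (B.norm_iteratedFDerivWithin_le_of_bilinear (hF.smooth i) (hG.smooth i)
    UnifSym.uniqueDiff hx (n := n) (by exact_mod_cast le_top)).trans ?_
  rw [mul_assoc, mul_assoc, Finset.sum_mul]
  refine mul_le_mul_of_nonneg_left (Finset.sum_le_sum fun k hk => ?_) (by positivity)
  have hk' : k ≤ n := by simpa [Nat.lt_succ_iff] using hk
  have h1 := hb k i x hx
  have h2 := hb' (n - k) i x hx
  have h3 : 0 ≤ C k * w i x * ‖x‖⁻¹ ^ k :=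
    mul_nonneg (mul_nonneg (hC k) (hw i x)) (by positivity)
  calc _ ≤ (n.choose k : ℝ) * (C k * w i x * ‖x‖⁻¹ ^ k) * (C' (n - k) * w' i x * ‖x‖⁻¹ ^ (n - k)) := by
        gcongr
    _ = _ := by
        have : ‖x‖⁻¹ ^ n = ‖x‖⁻¹ ^ k * ‖x‖⁻¹ ^ (n - k) := by rw [← pow_add]; congr 1; omega
        rw [this]; ring

theorem UnifSym.mul {F G : ι → E → ℂ}
    {w w' : ι → E → ℝ} (hw : ∀ i x, 0 ≤ w i x) (hF : UnifSym F w) (hG : UnifSym G w') :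
    UnifSym (fun i x => F i x * G i x) (fun i x => w i x * w' i x) :=
  UnifSym.bilin (ContinuousLinearMap.mul ℝ ℂ) hw hF hG

/-- Composition with a multiplicative function. -/
theorem UnifSym.comp {K : Type*} [NormedField K] [NormedAlgebra ℝ K] {F : ι → E → K}
    {w : ι → E → ℝ} (hF : UnifSym F w) (U : Set K) (hU : IsOpen U)
    (hdiv : ∀ a ∈ U, ∀ b ∈ U, b⁻¹ * a ∈ U) (h0 : (0 : K) ∉ U)
    (hFU : ∀ i x, x ≠ 0 → F i x ∈ U) (c : ℝ) (hc : 0 ≤ c)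
    (hcw : ∀ i x, x ≠ 0 → w i x ≤ c * ‖F i x‖)
    (g : K → ℂ) (hg : ContDiffOn ℝ ∞ g U) (hmul : ∀ a ∈ U, ∀ b ∈ U, g (a * b) = g a * g b) :
    UnifSym (fun i x => g (F i x)) (fun i x => ‖g (F i x)‖) := by
  refine ⟨fun i => hg.comp (hF.smooth i) (fun x hx => hFU i x hx), fun n => ?_⟩
  choose C hC hb using hF.bound
  set D : ℝ := 1 + ∑ k ∈ Finset.range (n + 1), C k * c with hD
  have hD1 : 1 ≤ D := by
    have : 0 ≤ ∑ k ∈ Finset.range (n + 1), C k * c :=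
      Finset.sum_nonneg fun k _ => mul_nonneg (hC k) hc
    linarith
  set M : ℝ := ∑ k ∈ Finset.range (n + 1), ‖iteratedFDerivWithin ℝ k g U 1‖ with hM
  have hM0 : 0 ≤ M := Finset.sum_nonneg fun k _ => norm_nonneg _
  refine ⟨n.factorial * M * D ^ n, by positivity, fun i x hx => ?_⟩
  have hne : ∀ y, y ≠ 0 → F i y ≠ 0 := fun y hy h => h0 (h ▸ hFU i y hy)
  set a := F i x with ha
  have ha0 : a ≠ 0 := hne x hx
  set h : E → K := fun y => a⁻¹ * F i y with hh
  have hhU : Set.MapsTo h {0}ᶜ U := fun y hy => hdiv _ (hFU i y hy) _ (hFU i x hx)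
  have hhs : ContDiffOn ℝ ∞ h {0}ᶜ := contDiffOn_const.mul (hF.smooth i)
  have hx1 : h x = 1 := inv_mul_cancel₀ ha0
  have heq : Set.EqOn (fun y => g (F i y))
      (((ContinuousLinearMap.mul ℝ ℂ) (g a)) ∘ (g ∘ h)) {0}ᶜ := by
    intro y hy
    simp only [Function.comp, ContinuousLinearMap.mul_apply']
    rw [← hmul _ (hFU i x hx) _ (hhU hy), hh]
    simp only
    rw [mul_inv_cancel_left₀ ha0]
  rw [iteratedFDerivWithin_congr heq hx]
  have hgh : ContDiffOn ℝ ∞ (g ∘ h) {0}ᶜ := hg.comp hhs hhU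
  have hnle : (n : ℕ∞ω) ≤ ∞ := by exact_mod_cast le_top
  refine (ContinuousLinearMap.norm_iteratedFDerivWithin_comp_left _ (hgh x hx)
    UnifSym.uniqueDiff hx hnle).trans ?_
  have hx0 : 0 < ‖x‖ := norm_pos_iff.2 hx
  have key : ‖iteratedFDerivWithin ℝ n (g ∘ h) {0}ᶜ x‖ ≤ n.factorial * M * (D * ‖x‖⁻¹) ^ n := by
    refine norm_iteratedFDerivWithin_comp_le hg hhs hnle hU.uniqueDiffOn
      UnifSym.uniqueDiff hhU hx ?_ ?_
    · intro k hk
      rw [hx1]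
      exact Finset.single_le_sum (f := fun k => ‖iteratedFDerivWithin ℝ k g U 1‖)
        (fun _ _ => norm_nonneg _) (Finset.mem_range.2 (Nat.lt_succ_of_le hk))
    · intro k hk1 hk
      have hsm : h = ((ContinuousLinearMap.mul ℝ K) a⁻¹) ∘ (F i) := by
        ext y; simp [hh]
      rw [hsm]
      refine (ContinuousLinearMap.norm_iteratedFDerivWithin_comp_left _ (hF.smooth i x hx)
        UnifSym.uniqueDiff hx (by exact_mod_cast le_top)).trans ?_
      have hn1 : ‖(ContinuousLinearMap.mul ℝ K) a⁻¹‖ ≤ ‖a‖⁻¹ := by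
        rw [← norm_inv]; exact ContinuousLinearMap.opNorm_mul_apply_le _ _ _
      have ha1 : 0 < ‖a‖ := norm_pos_iff.2 ha0
      have hCk : C k * c ≤ D := by
        have := Finset.single_le_sum (f := fun k => C k * c)
          (fun k _ => mul_nonneg (hC k) hc) (Finset.mem_range.2 (Nat.lt_succ_of_le hk))
        linarith
      calc _ ≤ ‖a‖⁻¹ * (C k * (c * ‖a‖) * ‖x‖⁻¹ ^ k) := by
            refine mul_le_mul hn1 ((hb k i x hx).trans ?_) (norm_nonneg _) (by positivity)
            have := hcw i x hx
            have := hC k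
            gcongr
        _ = (C k * c) * ‖x‖⁻¹ ^ k := by field_simp
        _ ≤ D ^ k * ‖x‖⁻¹ ^ k := by
            gcongr
            exact hCk.trans (le_self_pow₀ hD1 (by omega))
        _ = _ := by rw [mul_pow]
  have hn2 : ‖(ContinuousLinearMap.mul ℝ ℂ) (g a)‖ ≤ ‖g a‖ :=
    ContinuousLinearMap.opNorm_mul_apply_le _ _ _
  calc _ ≤ ‖g a‖ * (n.factorial * M * (D * ‖x‖⁻¹) ^ n) :=
        mul_le_mul hn2 key (norm_nonneg _) (norm_nonneg _)
    _ = _ := by rw [mul_pow]; ring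

end UnifSymLemmas

/-- Lower bound for `λ + γ R` when `-γ` is separated in argument from `λ`. -/
theorem sector_lower_bound (ϑ ϑ₀ : ℝ) (h0 : 0 < ϑ) (h1 : ϑ < ϑ₀) (h2 : ϑ₀ ≤ Real.pi) (z : ℂ)
    (hz : z ≠ 0) (hzarg : ϑ₀ ≤ |z.arg|) :
    ∃ c > 0, ∀ lam : ℂ, |lam.arg| < ϑ → ∀ R : ℝ, 0 ≤ R → ‖lam‖ + R ≤ c * ‖lam - z * R‖ := by
  set κ := Real.cos (ϑ₀ - ϑ) with hκ
  have hκ1 : κ < 1 := by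
    rw [hκ, ← Real.cos_zero]
    exact Real.cos_lt_cos_of_nonneg_of_le_pi le_rfl (by linarith) (by linarith)
  have hκ2 : -1 ≤ κ := Real.neg_one_le_cos _
  have hz0 : 0 < ‖z‖ := norm_pos_iff.2 hz
  set s := Real.sqrt ((1 - κ) / 2) with hs
  have hs0 : 0 < s := Real.sqrt_pos.2 (by linarith)
  have hs2 : s ^ 2 = (1 - κ) / 2 := Real.sq_sqrt (by linarith)
  refine ⟨(1 + ‖z‖⁻¹) * s⁻¹, by positivity, fun lam hlam R hR => ?_⟩
  have hcos : Real.cos (lam.arg - z.arg) ≤ κ := by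
    have hzp := Complex.abs_arg_le_pi z
    rw [← Real.cos_abs (lam.arg - z.arg)]
    have hlow : ϑ₀ - ϑ ≤ |lam.arg - z.arg| := by
      have := abs_sub_abs_le_abs_sub z.arg lam.arg
      rw [abs_sub_comm] at this
      linarith
    have hup : |lam.arg - z.arg| ≤ ϑ + Real.pi := by
      have := abs_sub lam.arg z.arg
      linarith
    rcases le_total |lam.arg - z.arg| Real.pi with h | h
    · exact Real.cos_le_cos_of_nonneg_of_le_pi (by linarith) h hlow
    · rw [← Real.cos_two_pi_sub]
      exact Real.cos_le_cos_of_nonneg_of_le_pi (by linarith) (by linarith) (by linarith)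
  have hsq : ‖lam - z * R‖ ^ 2 = ‖lam‖ ^ 2 + (‖z‖ * R) ^ 2
      - 2 * (‖lam‖ * (‖z‖ * R)) * Real.cos (lam.arg - z.arg) := by
    rw [Real.cos_sub, Complex.sq_norm, Complex.normSq_apply]
    simp only [Complex.sub_re, Complex.sub_im, Complex.mul_re, Complex.mul_im, Complex.ofReal_re,
      Complex.ofReal_im]
    rw [← Complex.norm_mul_cos_arg lam, ← Complex.norm_mul_sin_arg lam,
      ← Complex.norm_mul_cos_arg z, ← Complex.norm_mul_sin_arg z]
    have e1 := Real.sin_sq_add_cos_sq lam.arg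
    have e2 := Real.sin_sq_add_cos_sq z.arg
    linear_combination ‖lam‖ ^ 2 * e1 + (‖z‖ * R) ^ 2 * e2
  have hge : s * (‖lam‖ + ‖z‖ * R) ≤ ‖lam - z * R‖ := by
    refine (sq_le_sq₀ (by positivity) (norm_nonneg _)).1 ?_
    rw [hsq, mul_pow, hs2]
    have hp : 0 ≤ ‖lam‖ * (‖z‖ * R) := by positivity
    nlinarith [mul_le_mul_of_nonneg_left hcos hp, mul_nonneg (show 0 ≤ 1 + κ by linarith)
      (sq_nonneg (‖lam‖ - ‖z‖ * R))]
  calc ‖lam‖ + R ≤ (1 + ‖z‖⁻¹) * (‖lam‖ + ‖z‖ * R) := by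
        have : (1 + ‖z‖⁻¹) * (‖lam‖ + ‖z‖ * R) = ‖lam‖ + ‖z‖ * R + ‖z‖⁻¹ * ‖lam‖ + R := by
          field_simp
          ring
        rw [this]
        have : 0 ≤ ‖z‖ * R + ‖z‖⁻¹ * ‖lam‖ := by positivity
        linarith
    _ = (1 + ‖z‖⁻¹) * s⁻¹ * (s * (‖lam‖ + ‖z‖ * R)) := by field_simp
    _ ≤ _ := by gcongr

/-- The shifted sector is contained in the sector. -/
theorem shifted_sector_arg (ϑ lam₀ : ℝ) (h0 : Real.pi / 2 < ϑ) (h1 : ϑ < Real.pi) (hl : 0 < lam₀)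
    (μ : ℂ) (hμ : |μ.arg| < ϑ) :
    (lam₀ : ℂ) + μ ≠ 0 ∧ |((lam₀ : ℂ) + μ).arg| < ϑ := by
  have hpi := Real.pi_pos
  have hk : Real.cos ϑ < 0 := Real.cos_neg_of_pi_div_two_lt_of_lt h0 (by linarith)
  have hk1 : -1 < Real.cos ϑ := by
    rw [← Real.cos_pi]
    exact Real.cos_lt_cos_of_nonneg_of_le_pi (by linarith) le_rfl h1
  have hμ' : ‖μ‖ * Real.cos ϑ ≤ μ.re := by
    rw [← Complex.norm_mul_cos_arg μ]
    gcongr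
    rw [← Real.cos_abs μ.arg]
    exact Real.cos_le_cos_of_nonneg_of_le_pi (abs_nonneg _) h1.le hμ.le
  have hnorm : ‖μ‖ - lam₀ ≤ ‖(lam₀ : ℂ) + μ‖ := by
    have := norm_sub_le ((lam₀ : ℂ) + μ) (lam₀ : ℂ)
    rw [add_sub_cancel_left, Complex.norm_of_nonneg hl.le] at this
    linarith
  have hmain : ‖(lam₀ : ℂ) + μ‖ * Real.cos ϑ < ((lam₀ : ℂ) + μ).re := by
    simp only [Complex.add_re, Complex.ofReal_re]
    nlinarith
  have hne : (lam₀ : ℂ) + μ ≠ 0 := by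
    intro h
    rw [h] at hmain
    simp at hmain
  refine ⟨hne, ?_⟩
  by_contra! hcon
  rw [← Complex.norm_mul_cos_arg, ← Real.cos_abs (Complex.arg _)] at hmain
  have := lt_of_mul_lt_mul_left hmain (norm_nonneg _)
  have h3 := Real.cos_le_cos_of_nonneg_of_le_pi (by linarith) (Complex.abs_arg_le_pi _) hcon
  linarith

section Blocks

variable {ι E : Type*} [NormedAddCommGroup E] [InnerProductSpace ℝ E]

theorem UnifSym.normSqReal : UnifSym (fun (_ : ι) (x : E) => ‖x‖ ^ 2) (fun _ x => ‖x‖ ^ 2) := by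
  have h := UnifSym.bilin (ι := ι) (innerSL ℝ (E := E)) (fun _ x => norm_nonneg x)
    UnifSym.id UnifSym.id
  refine ⟨fun i => ?_, fun n => ?_⟩
  · exact (contDiff_norm_sq ℝ).contDiffOn
  · have e : (fun x : E => ‖x‖ ^ 2) = fun x => innerSL ℝ x x := by
      ext x
      exact (real_inner_self_eq_norm_sq x).symm
    have h' := h.bound n
    simp only [← sq] at h'
    simp only [e]
    exact h'

theorem UnifSym.normSq : UnifSym (fun (_ : ι) (x : E) => (‖x‖ : ℂ) ^ 2) (fun _ x => ‖x‖ ^ 2) := by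
  have h := UnifSym.bilin (ι := ι) (ContinuousLinearMap.lsmul ℝ ℝ : ℝ →L[ℝ] ℂ →L[ℝ] ℂ)
    (fun _ x => by positivity) (UnifSym.normSqReal (E := E)) (UnifSym.const fun _ => (1 : ℂ))
  simpa using h

theorem UnifSym.affine (lam : ι → ℂ) (γ : ℂ) :
    UnifSym (fun i (x : E) => lam i + γ * (‖x‖ : ℂ) ^ 2) (fun i x => ‖lam i‖ + ‖x‖ ^ 2) := by
  refine UnifSym.add ?_ ?_
  · refine (UnifSym.const lam).mono 1 zero_le_one fun i x _ => ?_
    have : 0 ≤ ‖x‖ ^ 2 := by positivity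
    linarith
  · refine (UnifSym.mul (fun _ _ => norm_nonneg _) (UnifSym.const fun _ => γ)
      UnifSym.normSq).mono ‖γ‖ (norm_nonneg _) fun i x _ => ?_
    have : 0 ≤ ‖lam i‖ := norm_nonneg _
    gcongr
    linarith

theorem UnifSym.affineInv (lam : ι → ℂ) (γ : ℂ) (hlam : ∀ i, lam i ≠ 0) (c : ℝ) (hc : 0 < c)
    (h : ∀ i, ∀ R : ℝ, 0 ≤ R → ‖lam i‖ + R ≤ c * ‖lam i + γ * R‖) :
    UnifSym (fun i (x : E) => (lam i + γ * (‖x‖ : ℂ) ^ 2)⁻¹)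
      (fun i x => (‖lam i‖ + ‖x‖ ^ 2)⁻¹) := by
  have hb : ∀ i (x : E), ‖lam i‖ + ‖x‖ ^ 2 ≤ c * ‖lam i + γ * (‖x‖ : ℂ) ^ 2‖ := by
    intro i x
    have := h i (‖x‖ ^ 2) (by positivity)
    push_cast at this
    exact this
  have hp : ∀ i (x : E), 0 < ‖lam i‖ + ‖x‖ ^ 2 := fun i x => by
    have := norm_pos_iff.2 (hlam i)
    positivity
  have hp' : ∀ i (x : E), 0 < ‖lam i + γ * (‖x‖ : ℂ) ^ 2‖ := fun i x =>
    pos_of_mul_pos_right ((hp i x).trans_le (hb i x)) hc.le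
  refine (UnifSym.comp (UnifSym.affine lam γ) ({0}ᶜ : Set ℂ) isOpen_compl_singleton
    ?_ (by simp) (fun i x _ => norm_pos_iff.1 (hp' i x)) c hc.le (fun i x _ => hb i x)
    (fun z => z⁻¹) ?_ ?_).mono c hc.le ?_
  · intro a ha b hb
    simp only [Set.mem_compl_iff, Set.mem_singleton_iff] at *
    exact mul_ne_zero (inv_ne_zero hb) ha
  · intro z hz
    exact (contDiffAt_inv ℝ hz).contDiffWithinAt
  · intro a _ b _
    exact mul_inv a b
  · intro i x _
    rw [norm_inv, ← div_eq_mul_inv, inv_eq_one_div, div_le_div_iff₀ (hp' i x) (hp i x), one_mul]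
    exact hb i x

theorem UnifSym.japanese (s : ℝ) :
    UnifSym (fun (_ : ι) (x : E) => (((1 + ‖x‖ ^ 2) ^ s : ℝ) : ℂ))
      (fun _ x => (1 + ‖x‖ ^ 2) ^ s) := by
  have h1 : UnifSym (fun (_ : ι) (x : E) => 1 + ‖x‖ ^ 2) (fun _ x => 1 + ‖x‖ ^ 2) := by
    refine UnifSym.add ?_ ?_
    · refine (UnifSym.const fun _ => (1 : ℝ)).mono 1 zero_le_one fun i x _ => ?_
      have : 0 ≤ ‖x‖ ^ 2 := by positivity
      simpa using this
    · exact UnifSym.normSqReal.mono 1 zero_le_one fun i x _ => by linarith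
  refine (UnifSym.comp h1 (Set.Ioi 0) isOpen_Ioi ?_ (by simp)
    (fun i x _ => ?_) 1 zero_le_one (fun i x _ => ?_) (fun t => ((t ^ s : ℝ) : ℂ)) ?_ ?_).mono
    1 zero_le_one ?_
  · intro a ha b hb
    simp only [Set.mem_Ioi] at *
    positivity
  · simp only [Set.mem_Ioi]
    positivity
  · rw [one_mul]
    exact le_abs_self _
  · refine Complex.ofRealCLM.contDiff.comp_contDiffOn (f := fun t : ℝ => t ^ s) ?_
    intro t ht
    exact (Real.contDiffAt_rpow_const_of_ne (ne_of_gt ht)).contDiffWithinAt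
  · intro a ha b hb
    rw [Real.mul_rpow (le_of_lt ha) (le_of_lt hb)]
    push_cast
    rfl
  · intro i x _
    rw [one_mul, Complex.norm_of_nonneg (by positivity)]

end Blocks

theorem weight_bound (A R : ℝ) (hA : 0 < A) (hR : 0 ≤ R) (j : ℕ) (hj : j ≤ 2) :
    A ^ ((j : ℝ) / 2) * (1 + R) ^ (((2 : ℝ) - j) / 2) * (A + R) * (R * R) * (1 + R)⁻¹
      * ((A + R)⁻¹ * (A + R)⁻¹ * (A + R)⁻¹) ≤ 2 := by
  have hj' : (j : ℝ) ≤ 2 := by exact_mod_cast hj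
  have h1 : A ^ ((j : ℝ) / 2) * (1 + R) ^ (((2 : ℝ) - j) / 2) ≤ A + (1 + R) := by
    calc _ ≤ (A + (1 + R)) ^ ((j : ℝ) / 2) * (A + (1 + R)) ^ (((2 : ℝ) - j) / 2) := by
          have h2 : A ≤ A + (1 + R) := by linarith
          have h3 : 1 + R ≤ A + (1 + R) := by linarith
          have h4 : 0 ≤ ((2 : ℝ) - j) / 2 := by linarith
          have h5 : A ^ ((j : ℝ) / 2) ≤ (A + (1 + R)) ^ ((j : ℝ) / 2) :=
            Real.rpow_le_rpow hA.le h2 (by positivity)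
          have h6 := Real.rpow_le_rpow (by positivity) h3 h4
          gcongr
      _ = A + (1 + R) := by
          rw [← Real.rpow_add (by positivity)]
          convert Real.rpow_one _ using 2
          ring
  have hAR : 0 < A + R := by positivity
  calc _ ≤ (A + (1 + R)) * (A + R) * (R * R) * (1 + R)⁻¹
      * ((A + R)⁻¹ * (A + R)⁻¹ * (A + R)⁻¹) := by gcongr
    _ = ((A + (1 + R)) * (R * R)) / ((1 + R) * (A + R) ^ 2) := by field_simp
    _ ≤ 2 := by
      rw [div_le_iff₀ (by positivity)]
      have e1 : 0 ≤ A * R := by positivity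
      have e2 : 0 ≤ A * R * R := by positivity
      have e3 : 0 ≤ A * A * R := by positivity
      have e4 : 0 ≤ R * R * R := by positivity
      nlinarith [sq_nonneg A, sq_nonneg R]

/-- Let ϑ ∈ (π/2, ϑ₀) with ϑ₀ = arg(−γ₃), λ₀ > 0 and j ∈ {0, 1, 2}. For
every n ∈ ℕ there exists C > 0 such that for all λ ∈ λ₀ + Σ_ϑ and all
ξ ∈ ℝ^N ∖ {0} the entry
`m₂₁^{(j)}(ξ,λ) = −λ^{j/2}(1+|ξ|²)^{(2−j)/2}(λ+|ξ|²)·(|ξ|²/(1+|ξ|²))·|ξ|²·det(λI−A(ξ))^{−1}`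
satisfies `‖∂ⁿ_ξ m₂₁^{(j)}(ξ,λ)‖ ≤ C |ξ|^{−n}`, i.e. it is a multiplier of
order 0 on λ₀ + Σ_ϑ. -/
theorem m21_multiplier_order_zero
    (γ₁ : ℝ) (γ₂ γ₃ : ℂ)
    (hγ₃ : γ₃ = (starRingEnd ℂ) γ₂) (him : 0 < γ₂.im)
    (hfact : ∀ t : ℂ, t ^ 3 + t ^ 2 + 2 * t + 1
      = (t + (γ₁ : ℂ)) * (t + γ₂) * (t + γ₃))
    (ϑ : ℝ) (hϑ1 : Real.pi / 2 < ϑ) (hϑ2 : ϑ < Complex.arg (-γ₃))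
    (lam₀ : ℝ) (hlam₀ : 0 < lam₀)
    (j : ℕ) (hj : j ≤ 2)
    (N : ℕ) (hN : 2 ≤ N) (n : ℕ) :
    ∃ C > 0, ∀ lam : ℂ,
      (∃ μ : ℂ, μ ≠ 0 ∧ |μ.arg| < ϑ ∧ lam = (lam₀ : ℂ) + μ) →
      ∀ ξ : EuclideanSpace ℝ (Fin N), ξ ≠ 0 →
        ‖iteratedFDeriv ℝ n
            (fun ξ : EuclideanSpace ℝ (Fin N) =>
              lam ^ ((j : ℂ) / 2)
                * ((((1 + ‖ξ‖ ^ 2) ^ (((2 : ℝ) - j) / 2) : ℝ)) : ℂ)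
                * (lam + (‖ξ‖ : ℂ) ^ 2) * (‖ξ‖ : ℂ) ^ 4
                * ((1 : ℂ) + (‖ξ‖ : ℂ) ^ 2)⁻¹
                / ((lam + (γ₁ : ℂ) * (‖ξ‖ : ℂ) ^ 2) * (lam + γ₂ * (‖ξ‖ : ℂ) ^ 2)
                    * (lam + γ₃ * (‖ξ‖ : ℂ) ^ 2))) ξ‖
          ≤ C * ‖ξ‖ ^ (-(n : ℝ)) := by
  have hpi := Real.pi_pos
  have hϑ0 : 0 < ϑ := by linarith
  have hle : Complex.arg (-γ₃) ≤ Real.pi := Complex.arg_le_pi _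
  have hγ1 : 0 < γ₁ := by
    by_contra! hcon
    have h := hfact (-(γ₁ : ℂ))
    rw [neg_add_cancel, zero_mul, zero_mul] at h
    have h' : (-γ₁) ^ 3 + (-γ₁) ^ 2 + 2 * (-γ₁) + 1 = 0 := by exact_mod_cast h
    have hp : 0 ≤ -γ₁ := by linarith
    have : 0 < (-γ₁) ^ 3 + (-γ₁) ^ 2 + 2 * (-γ₁) + 1 := by positivity
    linarith
  have hγ2 : -γ₂ ≠ 0 := by
    intro h
    rw [neg_eq_zero] at h
    rw [h] at him
    simp at him
  have hγ3 : -γ₃ ≠ 0 := by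
    intro h
    rw [h, Complex.arg_zero] at hϑ2
    linarith
  obtain ⟨c₁, hc₁, hb₁⟩ := sector_lower_bound ϑ _ hϑ0 hϑ2 hle (-(γ₁ : ℂ))
    (by simpa using hγ1.ne') (by
      rw [← Complex.ofReal_neg, Complex.arg_ofReal_of_neg (by linarith), abs_of_pos hpi]
      exact hle)
  obtain ⟨c₂, hc₂, hb₂⟩ := sector_lower_bound ϑ _ hϑ0 hϑ2 hle (-γ₂) hγ2 (by
      have e : -γ₂ = (starRingEnd ℂ) (-γ₃) := by rw [hγ₃]; simp
      rw [e, Complex.arg_conj]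
      split_ifs with h
      · rw [abs_of_pos hpi]; exact hle
      · rw [abs_neg]; exact le_abs_self _)
  obtain ⟨c₃, hc₃, hb₃⟩ := sector_lower_bound ϑ _ hϑ0 hϑ2 hle (-γ₃) hγ3 (le_abs_self _)
  simp only [neg_mul, sub_neg_eq_add] at hb₁ hb₂ hb₃
  let ι : Type := {lam : ℂ // lam ≠ 0 ∧ |lam.arg| < ϑ}
  let L : ι → ℂ := fun i => i.1
  have hL : ∀ i, L i ≠ 0 := fun i => i.2.1
  let E := EuclideanSpace ℝ (Fin N)
  have s0 : UnifSym (fun (i : ι) (_ : E) => (L i) ^ ((j : ℂ) / 2))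
      (fun i _ => ‖L i‖ ^ ((j : ℝ) / 2)) := by
    refine (UnifSym.const fun i : ι => (L i) ^ ((j : ℂ) / 2)).mono 1 zero_le_one fun i x _ => ?_
    have e : ((j : ℂ) / 2) = (((j : ℝ) / 2 : ℝ) : ℂ) := by push_cast; rfl
    rw [one_mul, e, Complex.norm_cpow_real]
  have s1 : UnifSym (fun (_ : ι) (x : E) => (((1 + ‖x‖ ^ 2) ^ (((2 : ℝ) - j) / 2) : ℝ) : ℂ))
      (fun _ x => (1 + ‖x‖ ^ 2) ^ (((2 : ℝ) - j) / 2)) := UnifSym.japanese _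
  have s2 : UnifSym (fun (i : ι) (x : E) => L i + (‖x‖ : ℂ) ^ 2)
      (fun i x => ‖L i‖ + ‖x‖ ^ 2) := by
    simpa only [one_mul] using UnifSym.affine (E := E) L 1
  have s3 : UnifSym (fun (_ : ι) (x : E) => (‖x‖ : ℂ) ^ 4) (fun _ x => ‖x‖ ^ 2 * ‖x‖ ^ 2) := by
    have h := UnifSym.mul (ι := ι) (E := E) (fun _ x => by positivity)
      UnifSym.normSq UnifSym.normSq
    simpa only [← pow_add] using h
  have s4 : UnifSym (fun (_ : ι) (x : E) => ((1 : ℂ) + (‖x‖ : ℂ) ^ 2)⁻¹)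
      (fun _ x => (1 + ‖x‖ ^ 2)⁻¹) := by
    have h := UnifSym.affineInv (ι := ι) (E := E) (fun _ => 1) 1 (fun _ => one_ne_zero) 1 one_pos
      (fun _ R hR => by
        have e : (1 : ℂ) + 1 * (R : ℂ) = ((1 + R : ℝ) : ℂ) := by push_cast; ring
        rw [e, Complex.norm_of_nonneg (by positivity)]
        simp)
    simpa only [one_mul, norm_one] using h
  have d1 := UnifSym.affineInv (E := E) L (γ₁ : ℂ) hL c₁ hc₁ fun i R hR => hb₁ i.1 i.2.2 R hR
  have d2 := UnifSym.affineInv (E := E) L γ₂ hL c₂ hc₂ fun i R hR => hb₂ i.1 i.2.2 R hR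
  have d3 := UnifSym.affineInv (E := E) L γ₃ hL c₃ hc₃ fun i R hR => hb₃ i.1 i.2.2 R hR
  have dd := UnifSym.mul (fun i x => by positivity)
    (UnifSym.mul (fun i x => by positivity) d1 d2) d3
  have tot := UnifSym.mul (fun i x => by positivity) (UnifSym.mul (fun i x => by positivity)
    (UnifSym.mul (fun i x => by positivity) (UnifSym.mul (fun i x => by positivity)
    (UnifSym.mul (fun i x => by positivity) s0 s1) s2) s3) s4) dd
  obtain ⟨C, hC, hb⟩ := tot.bound n
  refine ⟨C * 2 + 1, by positivity, fun lam hlam ξ hξ => ?_⟩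
  obtain ⟨μ, -, hμ, rfl⟩ := hlam
  have hsec := shifted_sector_arg ϑ lam₀ hϑ1 (by linarith) hlam₀ μ hμ
  have h := hb ⟨_, hsec⟩ ξ hξ
  have hw := weight_bound ‖(lam₀ : ℂ) + μ‖ (‖ξ‖ ^ 2) (norm_pos_iff.2 hsec.1) (by positivity) j hj
  rw [iteratedFDerivWithin_of_isOpen n isOpen_compl_singleton hξ] at h
  simp only [div_eq_mul_inv, mul_inv] at h hw ⊢
  rw [Real.rpow_neg (norm_nonneg _), Real.rpow_natCast, ← inv_pow]
  refine h.trans ?_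
  gcongr
  calc _ ≤ C * 2 := mul_le_mul_of_nonneg_left hw hC
    _ ≤ C * 2 + 1 := by linarith
end
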